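/- Let X be a metric space, C > 0, and H : ℕ → Set X a sequence of subsets such that each H n is nonempty and compact, H (n+1) ⊆ H n, every connected component of H n has diameter at most 2^(-n) · C, and every connected component of H n contains at least two components of H (n+1). Then the intersection K = ⋂ n, H n has no isolated points: for every x ∈ K and every ε > 0 there exists y ∈ K with y ≠ x and dist x y < ε. -/

import Mathlib

open Metric

/-- A connected component of a closed set is closed. -/
theorem IsClosed.isClosed_connectedComponentIn {X : Type*} [TopologicalSpace X] {F : Set X}
    (hF : IsClosed F) (x : X) : IsClosed (connectedComponentIn F x) := by
  by_cases hx : x ∈ F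
  · refine isClosed_of_closure_subset ?_
    exact isPreconnected_connectedComponentIn.closure.subset_connectedComponentIn
      (subset_closure (mem_connectedComponentIn hx))
      (closure_minimal (connectedComponentIn_subset F x) hF)
  · rw [connectedComponentIn_eq_empty hx]
    exact isClosed_empty

/-- A component of a member of a nested sequence of compact sets meets the intersection of the
sequence, provided every component of a member meets the next member. -/
theorem exists_mem_iInter_mem_connectedComponentIn {X : Type*} [TopologicalSpace X] [T2Space X]
    {H : ℕ → Set X} (hcpt : ∀ n, IsCompact (H n)) (hnested : ∀ n, H (n + 1) ⊆ H n)
    (hnext : ∀ n, ∀ x ∈ H n, ∃ y ∈ H (n + 1), y ∈ connectedComponentIn (H n) x)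
    {m : ℕ} {w : X} (hw : w ∈ H m) :
    ∃ p ∈ ⋂ n, H n, p ∈ connectedComponentIn (H m) w := by
  have : Nonempty X := ⟨w⟩
  choose! f hf hfc using hnext
  let u : ℕ → X := fun k => Nat.rec w (fun k v => f (m + k) v) k
  have hu : ∀ k, u k ∈ H (m + k) := by
    intro k
    induction k with
    | zero => exact hw
    | succ k ih => exact hf (m + k) (u k) ih
  have hclosed : ∀ k, IsClosed (connectedComponentIn (H (m + k)) (u k)) := fun k =>
    (hcpt _).isClosed.isClosed_connectedComponentIn _
  obtain ⟨p, hp⟩ := IsCompact.nonempty_iInter_of_sequence_nonempty_isCompact_isClosed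
    (fun k => connectedComponentIn (H (m + k)) (u k))
    (fun k => by
      rw [connectedComponentIn_eq (hfc (m + k) (u k) (hu k))]
      exact connectedComponentIn_mono _ (hnested (m + k)))
    (fun k => ⟨u k, mem_connectedComponentIn (hu k)⟩)
    ((hcpt m).of_isClosed_subset (hclosed 0) (connectedComponentIn_subset _ _))
    hclosed
  rw [Set.mem_iInter] at hp
  refine ⟨p, Set.mem_iInter.2 fun n => ?_, hp 0⟩
  exact antitone_nat_of_succ_le hnested (Nat.le_add_left n m)
    (connectedComponentIn_subset _ _ (hp n))

/-- The intersection of a nested sequence of nonempty compact sets, whose connected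
components have diameters shrinking like `2 ^ (-n) * C` and such that each component
of `H n` contains at least two components of `H (n+1)`, has no isolated points. -/
theorem no_isolated_points_of_nested_sets
    {X : Type*} [MetricSpace X] (C : ℝ) (hC : 0 < C) (H : ℕ → Set X)
    (hne : ∀ n, (H n).Nonempty)
    (hcpt : ∀ n, IsCompact (H n))
    (hnested : ∀ n, H (n + 1) ⊆ H n)
    (hdiam : ∀ n, ∀ x ∈ H n,
      Metric.diam (connectedComponentIn (H n) x) ≤ (2 : ℝ) ^ (-(n : ℤ)) * C)
    (htwo : ∀ n, ∀ x ∈ H n, ∃ y ∈ H (n + 1), ∃ z ∈ H (n + 1),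
      y ∈ connectedComponentIn (H n) x ∧ z ∈ connectedComponentIn (H n) x ∧
      connectedComponentIn (H (n + 1)) y ≠ connectedComponentIn (H (n + 1)) z) :
    ∀ x ∈ ⋂ n, H n, ∀ ε : ℝ, 0 < ε →
      ∃ y ∈ ⋂ n, H n, y ≠ x ∧ dist x y < ε := by
  intro x hx ε hε
  rw [Set.mem_iInter] at hx
  obtain ⟨n, hn⟩ : ∃ n : ℕ, (2 : ℝ) ^ (-(n : ℤ)) * C < ε := by
    obtain ⟨n, hn⟩ := exists_pow_lt_of_lt_one (div_pos hε hC) (by norm_num : (2⁻¹ : ℝ) < 1)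
    refine ⟨n, ?_⟩
    rw [zpow_neg, zpow_natCast, ← inv_pow]
    exact (lt_div_iff₀ hC).1 hn
  obtain ⟨w, hw, hwx, hwne⟩ : ∃ w ∈ H (n + 1), w ∈ connectedComponentIn (H n) x ∧
      connectedComponentIn (H (n + 1)) w ≠ connectedComponentIn (H (n + 1)) x := by
    obtain ⟨y, hy, z, hz, hyx, hzx, hyz⟩ := htwo n x (hx n)
    by_cases h : connectedComponentIn (H (n + 1)) y = connectedComponentIn (H (n + 1)) x
    · exact ⟨z, hz, hzx, fun h' => hyz (h.trans h'.symm)⟩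
    · exact ⟨y, hy, hyx, h⟩
  have hnext : ∀ n, ∀ x ∈ H n, ∃ y ∈ H (n + 1), y ∈ connectedComponentIn (H n) x := by
    intro n x hx
    obtain ⟨y, hy, -, -, hyx, -⟩ := htwo n x hx
    exact ⟨y, hy, hyx⟩
  obtain ⟨p, hpK, hpw⟩ := exists_mem_iInter_mem_connectedComponentIn hcpt hnested hnext hw
  refine ⟨p, hpK, ?_, ?_⟩
  · rintro rfl
    exact hwne (connectedComponentIn_eq hpw)
  · have hpx : p ∈ connectedComponentIn (H n) x := by
      rw [connectedComponentIn_eq hwx]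
      exact connectedComponentIn_mono _ (hnested n) hpw
    exact ((dist_le_diam_of_mem ((hcpt n).isBounded.subset (connectedComponentIn_subset _ _))
      (mem_connectedComponentIn (hx n)) hpx).trans (hdiam n x (hx n))).trans_lt hn
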